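/- Sharpness example: Let p > 2, set 𝔭 := p−2, let 𝔮 ≥ 𝔭, take 𝔞 ≡ 1 and define u : Q₁ → ℝ by u(x,t) = |x|^{1+1/(1+𝔭)} + t. Then u is a viscosity solution of ∂ₜu = (|∇u|^𝔭 + |∇u|^𝔮)Δ_p^N u + f(x,t) in Q₁ with f(x,t) = 1 − [n − 1 + (p−1)/(1+𝔭)]·[((2+𝔭)/(1+𝔭))^{1+𝔭} + |x|^{(𝔮−𝔭)/(1+𝔭)}((2+𝔭)/(1+𝔭))^{1+𝔮}], and f ∈ L^∞(Q₁) ∩ C⁰(Q₁). Moreover u(0,0) = 0, ∇u(0,0) = 0, and with θ := (2+𝔭)/(1+𝔭) one has sup_{(x,t) ∈ Q_{r,θ}(0,0)} |u(x,t)| ≤ 2 r^{1+1/(1+𝔭)} for all r ∈ (0,1). -/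

import Mathlib

open Set Metric Filter MeasureTheory

noncomputable section

/-- `n`-dimensional Euclidean space. -/
abbrev Euc (n : ℕ) := EuclideanSpace ℝ (Fin n)

/-- Standard parabolic cylinder `B_r × (-r², 0]` centered at the origin. -/
def Qcyl (n : ℕ) (r : ℝ) : Set (Euc n × ℝ) :=
  {z | ‖z.1‖ < r ∧ -(r ^ 2) < z.2 ∧ z.2 ≤ 0}

/-- Intrinsic parabolic cylinder `B_r × (-r² λ^{-𝔭}, 0]`. -/
def QcylIntr (n : ℕ) (r lam pp : ℝ) : Set (Euc n × ℝ) :=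
  {z | ‖z.1‖ < r ∧ -(r ^ 2 * lam ^ (-pp)) < z.2 ∧ z.2 ≤ 0}

/-- The θ-parabolic cylinder `B_r(x₀) × (t₀ - r^θ, t₀]`. -/
def QcylTheta (n : ℕ) (r θ : ℝ) (x₀ : Euc n) (t₀ : ℝ) : Set (Euc n × ℝ) :=
  {z | ‖z.1 - x₀‖ < r ∧ t₀ - r ^ θ < z.2 ∧ z.2 ≤ t₀}

/-- Parabolic boundary of the θ-parabolic cylinder. -/
def parBdryTheta (n : ℕ) (r θ : ℝ) (x₀ : Euc n) (t₀ : ℝ) : Set (Euc n × ℝ) :=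
  {z | ‖z.1 - x₀‖ = r ∧ t₀ - r ^ θ ≤ z.2 ∧ z.2 < t₀} ∪
    {z | ‖z.1 - x₀‖ < r ∧ z.2 = t₀ - r ^ θ}

/-- The spatial gradient of a space-time function. -/
def sgrad {n : ℕ} (u : Euc n × ℝ → ℝ) (x : Euc n) (t : ℝ) : Euc n :=
  gradient (fun y => u (y, t)) x

/-- The spatial Hessian, as a continuous linear operator. -/
def hessOp {n : ℕ} (φ : Euc n → ℝ) (x : Euc n) : Euc n →L[ℝ] Euc n :=
  fderiv ℝ (fun y => gradient φ y) x

/-- The normalized `∞`-Laplacian `⟨D²φ (∇φ/|∇φ|), ∇φ/|∇φ|⟩`. -/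
def infLapN {n : ℕ} (φ : Euc n → ℝ) (x : Euc n) : ℝ :=
  @inner ℝ (Euc n) _ ((hessOp φ x) ((‖gradient φ x‖)⁻¹ • gradient φ x))
    ((‖gradient φ x‖)⁻¹ • gradient φ x)

/-- The normalized `p`-Laplacian `Δφ + (p-2)⟨D²φ (∇φ/|∇φ|), ∇φ/|∇φ|⟩`. -/
def pLapN {n : ℕ} (p : ℝ) (φ : Euc n → ℝ) (x : Euc n) : ℝ :=
  LinearMap.trace ℝ (Euc n) (hessOp φ x : Euc n →ₗ[ℝ] Euc n) + (p - 2) * infLapN φ x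

/-- `ℋ(x,t,ξ) = |ξ|^𝔭 + 𝔞(x,t)|ξ|^𝔮`. -/
def Hop {n : ℕ} (pp qq : ℝ) (a : Euc n × ℝ → ℝ) (z : Euc n × ℝ) (ξ : Euc n) : ℝ :=
  ‖ξ‖ ^ pp + a z * ‖ξ‖ ^ qq

/-- Test functions of class `C^{2,1}`: `C²` in space and `C¹` in time. -/
def IsTestC21 {n : ℕ} (φ : Euc n × ℝ → ℝ) : Prop :=
  (∀ t, ContDiff ℝ 2 fun x => φ (x, t)) ∧ ∀ x, ContDiff ℝ 1 fun s => φ (x, s)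

/-- Viscosity subsolution of `∂ₜ u - G(x,t)[u(·,t)] = f` on `Q`, where the
spatial operator `G` is evaluated on time slices of test functions. -/
def ViscSubsolOp {n : ℕ} (G : Euc n × ℝ → (Euc n → ℝ) → ℝ) (f : Euc n × ℝ → ℝ)
    (Q : Set (Euc n × ℝ)) (u : Euc n × ℝ → ℝ) : Prop :=
  ∀ x₀ : Euc n, ∀ t₀ : ℝ, (x₀, t₀) ∈ Q →
    (∀ φ : Euc n × ℝ → ℝ, IsTestC21 φ →
      IsLocalMaxOn (fun z => u z - φ z) Q (x₀, t₀) →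
      gradient (fun x => φ (x, t₀)) x₀ ≠ 0 →
      deriv (fun s => φ (x₀, s)) t₀ - G (x₀, t₀) (fun x => φ (x, t₀)) ≤ f (x₀, t₀)) ∧
    (∀ δ₁ : ℝ, 0 < δ₁ → ∀ φ : ℝ → ℝ, ContDiff ℝ 1 φ → φ t₀ = 0 →
      (∀ t ∈ Ioo (t₀ - δ₁) (t₀ + δ₁), u (x₀, t) - φ t ≤ u (x₀, t₀)) →
      (∃ ε > 0, ∀ x ∈ ball x₀ ε,
        sSup ((fun t => u (x, t) - φ t) '' Ioo (t₀ - δ₁) (t₀ + δ₁)) =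
          sSup ((fun t => u (x₀, t) - φ t) '' Ioo (t₀ - δ₁) (t₀ + δ₁))) →
      deriv φ t₀ ≤ f (x₀, t₀))

/-- Viscosity supersolution of `∂ₜ u - G(x,t)[u(·,t)] = f` on `Q`. -/
def ViscSupersolOp {n : ℕ} (G : Euc n × ℝ → (Euc n → ℝ) → ℝ) (f : Euc n × ℝ → ℝ)
    (Q : Set (Euc n × ℝ)) (u : Euc n × ℝ → ℝ) : Prop :=
  ∀ x₀ : Euc n, ∀ t₀ : ℝ, (x₀, t₀) ∈ Q →
    (∀ φ : Euc n × ℝ → ℝ, IsTestC21 φ →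
      IsLocalMinOn (fun z => u z - φ z) Q (x₀, t₀) →
      gradient (fun x => φ (x, t₀)) x₀ ≠ 0 →
      f (x₀, t₀) ≤ deriv (fun s => φ (x₀, s)) t₀ - G (x₀, t₀) (fun x => φ (x, t₀))) ∧
    (∀ δ₁ : ℝ, 0 < δ₁ → ∀ φ : ℝ → ℝ, ContDiff ℝ 1 φ → φ t₀ = 0 →
      (∀ t ∈ Ioo (t₀ - δ₁) (t₀ + δ₁), u (x₀, t₀) ≤ u (x₀, t) - φ t) →
      (∃ ε > 0, ∀ x ∈ ball x₀ ε,
        sInf ((fun t => u (x, t) - φ t) '' Ioo (t₀ - δ₁) (t₀ + δ₁)) =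
          sInf ((fun t => u (x₀, t) - φ t) '' Ioo (t₀ - δ₁) (t₀ + δ₁))) →
      f (x₀, t₀) ≤ deriv φ t₀)

/-- Viscosity solution for a general spatial operator. -/
def ViscSolOp {n : ℕ} (G : Euc n × ℝ → (Euc n → ℝ) → ℝ) (f : Euc n × ℝ → ℝ)
    (Q : Set (Euc n × ℝ)) (u : Euc n × ℝ → ℝ) : Prop :=
  ContinuousOn u Q ∧ ViscSubsolOp G f Q u ∧ ViscSupersolOp G f Q u

/-- The spatial operator `ℋ(x,t,∇φ) Δ_p^N φ` of the paper. -/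
def Gpq {n : ℕ} (p pp qq : ℝ) (a : Euc n × ℝ → ℝ) : Euc n × ℝ → (Euc n → ℝ) → ℝ :=
  fun z ψ => Hop pp qq a z (gradient ψ z.1) * pLapN p ψ z.1

/-- Viscosity subsolution of `∂ₜ u - ℋ(x,t,∇u) Δ_p^N u = f` on `Q`. -/
def ViscSubsol {n : ℕ} (p pp qq : ℝ) (a f : Euc n × ℝ → ℝ) (Q : Set (Euc n × ℝ))
    (u : Euc n × ℝ → ℝ) : Prop :=
  ViscSubsolOp (Gpq p pp qq a) f Q u

/-- Viscosity supersolution of `∂ₜ u - ℋ(x,t,∇u) Δ_p^N u = f` on `Q`. -/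
def ViscSupersol {n : ℕ} (p pp qq : ℝ) (a f : Euc n × ℝ → ℝ) (Q : Set (Euc n × ℝ))
    (u : Euc n × ℝ → ℝ) : Prop :=
  ViscSupersolOp (Gpq p pp qq a) f Q u

/-- (Continuous) viscosity solution of `∂ₜ u - ℋ(x,t,∇u) Δ_p^N u = f` on `Q`. -/
def ViscSol {n : ℕ} (p pp qq : ℝ) (a f : Euc n × ℝ → ℝ) (Q : Set (Euc n × ℝ))
    (u : Euc n × ℝ → ℝ) : Prop :=
  ContinuousOn u Q ∧ ViscSubsol p pp qq a f Q u ∧ ViscSupersol p pp qq a f Q u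

/-- The sup of `|g|` over a set (the `L^∞` norm on `Q`). -/
def supAbs {α : Type*} (g : α → ℝ) (Q : Set α) : ℝ :=
  sSup ((fun z => |g z|) '' Q)

/-- The oscillation of `g` over a set. -/
def oscOn {α : Type*} (g : α → ℝ) (Q : Set α) : ℝ :=
  sSup (g '' Q) - sInf (g '' Q)

/-- `g` is bounded on `Q`. -/
def BddOn {α : Type*} (g : α → ℝ) (Q : Set α) : Prop :=
  ∃ M, ∀ z ∈ Q, |g z| ≤ M

/-- Structural hypotheses (H2)–(H3) on the modulating coefficient over `Q₁`. -/
def HypA (n : ℕ) (a : Euc n × ℝ → ℝ) (aminus aplus A0 : ℝ) : Prop :=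
  0 < aminus ∧ (∀ z ∈ Qcyl n 1, aminus ≤ a z ∧ a z ≤ aplus) ∧
    (∀ t ∈ Ioc (-1 : ℝ) 0, ContDiffOn ℝ 1 (fun x => a (x, t)) (ball (0 : Euc n) 1)) ∧
    (∀ x ∈ ball (0 : Euc n) 1, ContDiffOn ℝ 1 (fun s => a (x, s)) (Ioc (-1 : ℝ) 0)) ∧
    ∀ z ∈ Qcyl n 1,
      ‖fderivWithin ℝ (fun x => a (x, z.2)) (ball (0 : Euc n) 1) z.1‖ ≤ A0 ∧
      ‖fderivWithin ℝ (fun s => a (z.1, s)) (Ioc (-1 : ℝ) 0) z.2‖ ≤ A0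

/-- (H4): the source term is continuous and bounded on `Q`. -/
def HypF {n : ℕ} (f : Euc n × ℝ → ℝ) (Q : Set (Euc n × ℝ)) : Prop :=
  ContinuousOn f Q ∧ BddOn f Q

/-- A Lipschitz-in-space bound for the coefficient `𝔞` on `Q`. -/
def LipXBound {n : ℕ} (a : Euc n × ℝ → ℝ) (Q : Set (Euc n × ℝ)) (L : ℝ) : Prop :=
  ∀ x y : Euc n, ∀ t : ℝ, (x, t) ∈ Q → (y, t) ∈ Q → |a (x, t) - a (y, t)| ≤ L * ‖x - y‖

open scoped Topology Gradient InnerProductSpace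

section SecondOrder

variable {n : ℕ}

theorem deriv_deriv_nonneg_of_isLocalMin {g : ℝ → ℝ} {a : ℝ} (h : IsLocalMin g a)
    (hc : ContinuousAt g a) : 0 ≤ deriv (deriv g) a := by
  by_contra! hneg
  have hmax := isLocalMax_of_deriv_deriv_neg hneg h.deriv_eq_zero hc
  have hconst : g =ᶠ[𝓝 a] fun _ => g a := by
    filter_upwards [h, hmax] with y h₁ h₂ using le_antisymm h₂ h₁
  have : deriv (deriv g) a = 0 := by
    rw [hconst.deriv.deriv_eq]
    simp
  exact hneg.ne this

theorem ContDiffAt.eventually_differentiableAt_two {f : Euc n → ℝ} {x : Euc n}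
    (hf : ContDiffAt ℝ 2 f x) : ∀ᶠ y in 𝓝 x, DifferentiableAt ℝ f y := by
  filter_upwards [hf.eventually (by simp)] with y hy using hy.differentiableAt (by simp)

theorem ContDiffAt.hasFDerivAt_gradient {f : Euc n → ℝ} {x : Euc n}
    (hf : ContDiffAt ℝ 2 f x) : HasFDerivAt (fun y => gradient f y) (hessOp f x) x := by
  have h : DifferentiableAt ℝ (fderiv ℝ f) x :=
    (hf.fderiv_right (m := 1) (by norm_num)).differentiableAt (by simp)
  exact ((InnerProductSpace.toDual ℝ (Euc n)).symm.differentiableAt.comp x h).hasFDerivAt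

theorem IsLocalMin.hessOp_nonneg {f : Euc n → ℝ} {x : Euc n} (h : IsLocalMin f x)
    (hf : ContDiffAt ℝ 2 f x) (v : Euc n) : 0 ≤ ⟪hessOp f x v, v⟫_ℝ := by
  have hline (s : ℝ) : HasDerivAt (fun s : ℝ => x + s • v) v s := by
    simpa using ((hasDerivAt_id s).smul_const v).const_add x
  have hcont : Tendsto (fun s : ℝ => x + s • v) (𝓝 0) (𝓝 x) := by
    simpa using (hline 0).continuousAt.tendsto
  have hd : deriv (fun s : ℝ => f (x + s • v)) =ᶠ[𝓝 0]
      fun s => ⟪gradient f (x + s • v), v⟫_ℝ := by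
    filter_upwards [hcont.eventually hf.eventually_differentiableAt_two] with s hs
    rw [inner_gradient_left]
    exact (hs.hasFDerivAt.comp_hasDerivAt s (hline s)).deriv
  have hdd : deriv (deriv fun s : ℝ => f (x + s • v)) 0 = ⟪hessOp f x v, v⟫_ℝ := by
    rw [hd.deriv_eq]
    have hg : HasFDerivAt (fun y => gradient f y) (hessOp f x) (x + (0 : ℝ) • v) := by
      simpa using hf.hasFDerivAt_gradient
    have := (hg.comp_hasDerivAt (0 : ℝ) (hline 0)).inner ℝ (hasDerivAt_const (0 : ℝ) v)
    simpa using this.deriv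
  rw [← hdd]
  refine deriv_deriv_nonneg_of_isLocalMin ?_ ?_
  · have := hcont.eventually h
    simpa [IsLocalMin, IsMinFilter] using this
  · have hfx : ContinuousAt f (x + (0 : ℝ) • v) := by simpa using hf.continuousAt
    exact ContinuousAt.comp (f := fun s : ℝ => x + s • v) hfx (hline 0).continuousAt

theorem gradient_sub_of_differentiableAt {f g : Euc n → ℝ} {x : Euc n}
    (hf : DifferentiableAt ℝ f x) (hg : DifferentiableAt ℝ g x) :
    gradient (fun y => f y - g y) x = gradient f x - gradient g x := by
  simp only [gradient]
  rw [fderiv_fun_sub hf hg, map_sub]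

theorem hessOp_sub {f g : Euc n → ℝ} {x : Euc n}
    (hf : ContDiffAt ℝ 2 f x) (hg : ContDiffAt ℝ 2 g x) :
    hessOp (fun y => f y - g y) x = hessOp f x - hessOp g x := by
  have h : (fun y => gradient (fun y => f y - g y) y) =ᶠ[𝓝 x]
      fun y => gradient f y - gradient g y := by
    filter_upwards [hf.eventually_differentiableAt_two, hg.eventually_differentiableAt_two]
      with y h₁ h₂ using gradient_sub_of_differentiableAt h₁ h₂
  exact ((hf.hasFDerivAt_gradient.sub hg.hasFDerivAt_gradient).congr_of_eventuallyEq h).fderiv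

theorem gradient_eq_of_isLocalMin_sub {f g : Euc n → ℝ} {x : Euc n}
    (h : IsLocalMin (fun y => f y - g y) x)
    (hf : DifferentiableAt ℝ f x) (hg : DifferentiableAt ℝ g x) :
    gradient f x = gradient g x := by
  rw [← sub_eq_zero, ← gradient_sub_of_differentiableAt hf hg]
  simp [gradient, h.fderiv_eq_zero]

/-- Touching functions have ordered normalized `p`-Laplacians when `p ≥ 2`. -/
theorem pLapN_le_of_isLocalMin_sub {f g : Euc n → ℝ} {x : Euc n} {p : ℝ} (hp : 2 ≤ p)
    (h : IsLocalMin (fun y => f y - g y) x)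
    (hf : ContDiffAt ℝ 2 f x) (hg : ContDiffAt ℝ 2 g x) :
    pLapN p g x ≤ pLapN p f x := by
  have hgrad := gradient_eq_of_isLocalMin_sub h (hf.differentiableAt (by simp))
    (hg.differentiableAt (by simp))
  have hle (v : Euc n) : ⟪hessOp g x v, v⟫_ℝ ≤ ⟪hessOp f x v, v⟫_ℝ := by
    have := h.hessOp_nonneg (hf.sub hg) v
    rw [hessOp_sub hf hg] at this
    simpa [inner_sub_left] using this
  unfold pLapN infLapN
  rw [hgrad]
  refine add_le_add ?_ (mul_le_mul_of_nonneg_left (hle _) (by linarith))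
  rw [LinearMap.trace_eq_sum_inner _ (EuclideanSpace.basisFun (Fin n) ℝ),
    LinearMap.trace_eq_sum_inner _ (EuclideanSpace.basisFun (Fin n) ℝ)]
  refine Finset.sum_le_sum fun i _ => ?_
  simpa only [real_inner_comm] using! hle (EuclideanSpace.basisFun (Fin n) ℝ i)

end SecondOrder

section NormPower

variable {n : ℕ}

theorem gradient_norm_rpow {β : ℝ} (hβ : 1 < β) (x : Euc n) :
    gradient (fun y : Euc n => ‖y‖ ^ β) x = (β * ‖x‖ ^ (β - 2)) • x := by
  refine HasGradientAt.gradient ?_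
  rw [hasGradientAt_iff_hasFDerivAt]
  convert! hasFDerivAt_norm_rpow x hβ using 1
  ext y
  simp

theorem norm_gradient_norm_rpow {β : ℝ} (hβ : 1 < β) {x : Euc n} (hx : x ≠ 0) :
    ‖gradient (fun y : Euc n => ‖y‖ ^ β) x‖ = β * ‖x‖ ^ (β - 1) := by
  have hρ : 0 < ‖x‖ := norm_pos_iff.2 hx
  rw [gradient_norm_rpow hβ, norm_smul, Real.norm_of_nonneg (by positivity), mul_assoc,
    ← Real.rpow_add_one hρ.ne']
  ring_nf

theorem contDiffAt_norm_rpow {β : ℝ} {x : Euc n} (hx : x ≠ 0) :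
    ContDiffAt ℝ 2 (fun y : Euc n => ‖y‖ ^ β) x :=
  (contDiffAt_norm ℝ hx).rpow_const_of_ne (norm_ne_zero_iff.2 hx)

theorem hessOp_norm_rpow_apply {β : ℝ} (hβ : 1 < β) {x : Euc n} (hx : x ≠ 0) (v : Euc n) :
    hessOp (fun y : Euc n => ‖y‖ ^ β) x v =
      (β * ‖x‖ ^ (β - 2)) • v + (β * (β - 2) * ‖x‖ ^ (β - 4) * ⟪x, v⟫_ℝ) • x := by
  have hρ : 0 < ‖x‖ := norm_pos_iff.2 hx
  have hnorm : HasFDerivAt (fun y : Euc n => ‖y‖ ^ (β - 2))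
      (((β - 2) * ‖x‖ ^ (β - 4)) • innerSL ℝ x) x := by
    have h := ((hasFDerivAt_id x).norm_sq).rpow_const (p := (β - 2) / 2)
      (Or.inl (by simpa using hx))
    have key (y : Euc n) (c : ℝ) : (‖y‖ ^ 2) ^ (c / 2) = ‖y‖ ^ c := by
      rw [← Real.rpow_natCast, ← Real.rpow_mul (norm_nonneg y)]
      congr 1
      push_cast
      ring
    convert! h using 1
    · ext y
      simp [key]
    · ext y
      have : (β - 2) / 2 - 1 = (β - 4) / 2 := by ring
      simp [this, key]
      ring
  have hgrad : HasFDerivAt (fun y => gradient (fun y : Euc n => ‖y‖ ^ β) y)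
      ((β * ‖x‖ ^ (β - 2)) • ContinuousLinearMap.id ℝ (Euc n) +
        (β • (((β - 2) * ‖x‖ ^ (β - 4)) • innerSL ℝ x)).smulRight x) x := by
    simp only [gradient_norm_rpow hβ]
    exact (hnorm.const_mul β).smul (hasFDerivAt_id x)
  rw [hessOp, hgrad.fderiv]
  simp [mul_assoc]

theorem pLapN_norm_rpow {p β : ℝ} (hβ : 1 < β) {x : Euc n} (hx : x ≠ 0) :
    pLapN p (fun y : Euc n => ‖y‖ ^ β) x =
      β * ‖x‖ ^ (β - 2) * (n - 1 + (p - 1) * (β - 1)) := by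
  have hρ : 0 < ‖x‖ := norm_pos_iff.2 hx
  have hpow : ‖x‖ ^ (β - 4) * ‖x‖ ^ 2 = ‖x‖ ^ (β - 2) := by
    rw [← Real.rpow_natCast ‖x‖ 2, ← Real.rpow_add hρ]
    norm_num
    ring_nf
  have htrace : LinearMap.trace ℝ (Euc n)
      (hessOp (fun y : Euc n => ‖y‖ ^ β) x : Euc n →ₗ[ℝ] Euc n) =
      β * ‖x‖ ^ (β - 2) * (n + (β - 2)) := by
    rw [LinearMap.trace_eq_sum_inner _ (EuclideanSpace.basisFun (Fin n) ℝ)]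
    have hi (i : Fin n) : ⟪EuclideanSpace.basisFun (Fin n) ℝ i,
        (hessOp (fun y : Euc n => ‖y‖ ^ β) x : Euc n →ₗ[ℝ] Euc n)
          (EuclideanSpace.basisFun (Fin n) ℝ i)⟫_ℝ =
        β * ‖x‖ ^ (β - 2) + β * (β - 2) * ‖x‖ ^ (β - 4) * x i ^ 2 := by
      rw [ContinuousLinearMap.coe_coe, hessOp_norm_rpow_apply hβ hx]
      have hx : ⟪EuclideanSpace.basisFun (Fin n) ℝ i, x⟫_ℝ = x i := EuclideanSpace.basisFun_inner ..
      rw [inner_add_right, inner_smul_right, inner_smul_right, real_inner_self_eq_norm_sq,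
        OrthonormalBasis.norm_eq_one, real_inner_comm, hx]
      ring
    rw [Finset.sum_congr rfl fun i _ => hi i, Finset.sum_add_distrib,
      ← Finset.mul_sum (a := β * (β - 2) * ‖x‖ ^ (β - 4)), ← EuclideanSpace.real_norm_sq_eq]
    simp only [Finset.sum_const, Finset.card_univ, Fintype.card_fin, nsmul_eq_mul]
    linear_combination β * (β - 2) * hpow
  have hunit : (‖gradient (fun y : Euc n => ‖y‖ ^ β) x‖)⁻¹ •
      gradient (fun y : Euc n => ‖y‖ ^ β) x = ‖x‖⁻¹ • x := by
    have hc : 0 < β * ‖x‖ ^ (β - 2) := by positivity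
    rw [gradient_norm_rpow hβ, norm_smul, Real.norm_of_nonneg hc.le, smul_smul]
    congr 1
    field_simp
  have hinf : infLapN (fun y : Euc n => ‖y‖ ^ β) x = β * ‖x‖ ^ (β - 2) * (β - 1) := by
    unfold infLapN
    rw [hunit, hessOp_norm_rpow_apply hβ hx]
    simp only [inner_add_left, inner_smul_left, inner_smul_right, real_inner_self_eq_norm_sq,
      conj_trivial]
    field_simp
    linear_combination (β - 2) * hpow
  rw [pLapN, htrace, hinf]
  ring

end NormPower

section Touching

variable {n : ℕ}

theorem deriv_nonpos_of_isLocalMinOn_Iic {g : ℝ → ℝ} {g' a : ℝ}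
    (h : IsLocalMinOn g (Iic a) a) (hg : HasDerivAt g g' a) : g' ≤ 0 := by
  have hy : (-1 : ℝ) ∈ posTangentConeAt (Iic a) a := by
    refine mem_posTangentConeAt_of_segment_subset ?_
    exact (convex_Iic a).segment_subset (by simp) (by simp)
  simpa using h.hasFDerivWithinAt_nonneg hg.hasFDerivAt.hasFDerivWithinAt hy

theorem IsLocalMinOn.space_slice {F : Euc n × ℝ → ℝ} {x : Euc n} {t : ℝ}
    (h : IsLocalMinOn F (Qcyl n 1) (x, t)) (hz : (x, t) ∈ Qcyl n 1) :
    IsLocalMin (fun y => F (y, t)) x := by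
  have hcont : Continuous fun y : Euc n => (y, t) := by fun_prop
  have hev : ∀ᶠ y in 𝓝 x, (y, t) ∈ Qcyl n 1 := by
    filter_upwards [continuous_norm.continuousAt.eventually_lt_const hz.1] with y hy
    exact ⟨hy, hz.2⟩
  exact (tendsto_nhdsWithin_iff.2 ⟨hcont.continuousAt.tendsto, hev⟩).eventually h

theorem IsLocalMinOn.time_slice {F : Euc n × ℝ → ℝ} {x : Euc n} {t : ℝ}
    (h : IsLocalMinOn F (Qcyl n 1) (x, t)) (hz : (x, t) ∈ Qcyl n 1) :
    IsLocalMinOn (fun s => F (x, s)) (Iic t) t := by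
  have hcont : Continuous fun s : ℝ => (x, s) := by fun_prop
  have hev : ∀ᶠ s in 𝓝[≤] t, (x, s) ∈ Qcyl n 1 := by
    filter_upwards [self_mem_nhdsWithin, nhdsWithin_le_nhds (lt_mem_nhds hz.2.1)] with s h₁ h₂
    exact ⟨hz.1, h₂, le_trans h₁ hz.2.2⟩
  exact (tendsto_nhdsWithin_iff.2
    ⟨hcont.continuousAt.tendsto.mono_left nhdsWithin_le_nhds, hev⟩).eventually h

theorem not_norm_rpow_locally_const (hn : 1 ≤ n) {β : ℝ} (hβ : 0 < β) (x₀ : Euc n) :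
    ¬ ∃ ε > 0, ∀ x ∈ ball x₀ ε, ‖x‖ ^ β = ‖x₀‖ ^ β := by
  rintro ⟨ε, hε, h⟩
  have hnorm (x : Euc n) (hx : x ∈ ball x₀ ε) : ‖x‖ = ‖x₀‖ :=
    (Real.rpow_left_inj (norm_nonneg _) (norm_nonneg _) hβ.ne').1 (h x hx)
  let v : Euc n := EuclideanSpace.single ⟨0, hn⟩ (ε / 2)
  have hv : ‖v‖ = ε / 2 := by
    rw [PiLp.norm_single, Real.norm_of_nonneg (by positivity)]
  have h₁ := hnorm (x₀ + v) (by rw [mem_ball_iff_norm, add_sub_cancel_left, hv]; linarith)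
  have h₂ := hnorm (x₀ - v) (by
    rw [mem_ball_iff_norm, sub_sub_cancel_left, norm_neg, hv]; linarith)
  have hpar := parallelogram_law_with_norm ℝ x₀ v
  rw [h₁, h₂, hv] at hpar
  nlinarith

theorem not_sSup_norm_rpow_add_locally_const (hn : 1 ≤ n) {β : ℝ} (hβ : 0 < β) (x₀ : Euc n)
    {g : ℝ → ℝ} {S : Set ℝ} (hS : S.Nonempty) (hg : BddAbove (g '' S)) :
    ¬ ∃ ε > 0, ∀ x ∈ ball x₀ ε,
      sSup ((fun t => ‖x‖ ^ β + g t) '' S) = sSup ((fun t => ‖x₀‖ ^ β + g t) '' S) := by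
  have key (c : ℝ) : sSup ((fun t => c + g t) '' S) = c + sSup (g '' S) := by
    have := (OrderIso.addLeft c).map_csSup' (hS.image g) hg
    rw [image_image] at this
    simpa using this.symm
  rintro ⟨ε, hε, h⟩
  refine not_norm_rpow_locally_const hn hβ x₀ ⟨ε, hε, fun x hx => ?_⟩
  have := h x hx
  rw [key, key] at this
  linarith

theorem not_sInf_norm_rpow_add_locally_const (hn : 1 ≤ n) {β : ℝ} (hβ : 0 < β) (x₀ : Euc n)
    {g : ℝ → ℝ} {S : Set ℝ} (hS : S.Nonempty) (hg : BddBelow (g '' S)) :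
    ¬ ∃ ε > 0, ∀ x ∈ ball x₀ ε,
      sInf ((fun t => ‖x‖ ^ β + g t) '' S) = sInf ((fun t => ‖x₀‖ ^ β + g t) '' S) := by
  have key (c : ℝ) : sInf ((fun t => c + g t) '' S) = c + sInf (g '' S) := by
    have := (OrderIso.addLeft c).map_csInf' (hS.image g) hg
    rw [image_image] at this
    simpa using this.symm
  rintro ⟨ε, hε, h⟩
  refine not_norm_rpow_locally_const hn hβ x₀ ⟨ε, hε, fun x hx => ?_⟩
  have := h x hx
  rw [key, key] at this
  linarith

theorem Gpq_one_le_of_isLocalMin_sub {f g : Euc n → ℝ} {x : Euc n} {p pp qq t : ℝ} (hp : 2 ≤ p)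
    (h : IsLocalMin (fun y => f y - g y) x)
    (hf : ContDiffAt ℝ 2 f x) (hg : ContDiffAt ℝ 2 g x) :
    Gpq p pp qq (fun _ => 1) (x, t) g ≤ Gpq p pp qq (fun _ => 1) (x, t) f := by
  have hgrad := gradient_eq_of_isLocalMin_sub h (hf.differentiableAt (by simp))
    (hg.differentiableAt (by simp))
  unfold Gpq Hop
  rw [hgrad]
  exact mul_le_mul_of_nonneg_left (pLapN_le_of_isLocalMin_sub hp h hf hg) (by positivity)

/-- The power `|x|^{p/(p-1)}` turns the operator into an explicit function of `|x|`. -/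
theorem Gpq_norm_rpow {p qq β t : ℝ} (hp : 1 < p) (hβ : β = p / (p - 1)) {x : Euc n}
    (hx : x ≠ 0) :
    Gpq p (p - 2) qq (fun _ => 1) (x, t) (fun y : Euc n => ‖y‖ ^ β) =
      n * (β ^ (p - 1) + ‖x‖ ^ ((qq - (p - 2)) / (p - 1)) * β ^ (1 + qq)) := by
  have hρ : 0 < ‖x‖ := norm_pos_iff.2 hx
  have hp1 : 0 < p - 1 := by linarith
  have hβ1 : 1 < β := by rw [hβ, one_lt_div hp1]; linarith
  have hβ0 : 0 < β := by linarith
  have hcoef : (p - 1) * (β - 1) = 1 := by rw [hβ]; field_simp; ring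
  have key (s : ℝ) : (β * ‖x‖ ^ (β - 1)) ^ s * (β * ‖x‖ ^ (β - 2)) =
      β ^ (1 + s) * ‖x‖ ^ ((s - (p - 2)) / (p - 1)) := by
    have he : (s - (p - 2)) / (p - 1) = (β - 1) * s + (β - 2) := by
      rw [hβ]; field_simp; ring
    rw [he, Real.mul_rpow hβ0.le (by positivity), ← Real.rpow_mul hρ.le, Real.rpow_add hρ,
      Real.rpow_add hβ0, Real.rpow_one]
    ring
  simp only [Gpq, Hop]
  rw [norm_gradient_norm_rpow hβ1 hx, pLapN_norm_rpow hβ1 hx, hcoef]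
  have h₁ := key (p - 2)
  have h₂ := key qq
  rw [sub_self, zero_div, Real.rpow_zero, mul_one, show 1 + (p - 2) = p - 1 by ring] at h₁
  linear_combination (n : ℝ) * h₁ + (n : ℝ) * h₂

end Touching

/-- Example 7.2: sharpness of the regularity exponent of
Theorem 1.2, exhibited by `u(x,t) = |x|^{1 + 1/(1+𝔭)} + t` with `𝔭 = p - 2 > 0`. -/
theorem sharpness_example
    (n : ℕ) (hn : 1 ≤ n) (p : ℝ) (hp : 2 < p) (qq : ℝ) (hq : p - 2 ≤ qq) :
    let pp : ℝ := p - 2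
    let β : ℝ := 1 + 1 / (1 + pp)
    let θ : ℝ := (2 + pp) / (1 + pp)
    let u : Euc n × ℝ → ℝ := fun z => ‖z.1‖ ^ β + z.2
    let f : Euc n × ℝ → ℝ := fun z =>
      1 - ((n : ℝ) - 1 + (p - 1) / (1 + pp)) *
        (((2 + pp) / (1 + pp)) ^ (1 + pp) +
          ‖z.1‖ ^ ((qq - pp) / (1 + pp)) * ((2 + pp) / (1 + pp)) ^ (1 + qq))
    ViscSol p pp qq (fun _ => (1 : ℝ)) f (Qcyl n 1) u ∧
    HypF f (Qcyl n 1) ∧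
    u (0, 0) = 0 ∧
    sgrad u 0 0 = 0 ∧
    ∀ r ∈ Ioo (0 : ℝ) 1, ∀ z ∈ QcylTheta n r θ 0 0, |u z| ≤ 2 * r ^ β := by
  intro pp β θ u f
  have hp1 : 0 < p - 1 := by linarith
  have hpp : 1 + pp = p - 1 := by ring
  have hβ : β = p / (p - 1) := by
    change 1 + 1 / (1 + pp) = _
    rw [hpp]; field_simp; ring
  have hθ : (2 + pp) / (1 + pp) = β := by
    rw [hβ, hpp]; congr 1; ring
  have hβ1 : 1 < β := by rw [hβ, one_lt_div hp1]; linarith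
  have hβ0 : 0 < β := by linarith
  have hexp : 0 ≤ (qq - pp) / (p - 1) := div_nonneg (sub_nonneg.2 hq) hp1.le
  have hf (z : Euc n × ℝ) : f z =
      1 - n * (β ^ (p - 1) + ‖z.1‖ ^ ((qq - pp) / (p - 1)) * β ^ (1 + qq)) := by
    change 1 - _ * _ = _
    rw [hθ, hpp, div_self hp1.ne']
    ring
  have hfG {x : Euc n} (hx : x ≠ 0) (t : ℝ) :
      f (x, t) = 1 - Gpq p pp qq (fun _ => 1) (x, t) (fun y : Euc n => ‖y‖ ^ β) := by
    rw [hf, Gpq_norm_rpow (by linarith) hβ hx]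
  have hwd (x : Euc n) : DifferentiableAt ℝ (fun y : Euc n => ‖y‖ ^ β) x :=
    (hasFDerivAt_norm_rpow x hβ1).differentiableAt
  have hw0 : gradient (fun y : Euc n => ‖y‖ ^ β) 0 = 0 := by
    rw [gradient_norm_rpow hβ1, smul_zero]
  have hIoo {t δ : ℝ} (hδ : 0 < δ) : (Ioo (t - δ) (t + δ)).Nonempty :=
    ⟨t, by constructor <;> linarith⟩
  refine ⟨⟨?_, ?_, ?_⟩, ⟨?_, ?_⟩, ?_, ?_, ?_⟩
  · refine Continuous.continuousOn ?_
    exact (continuous_fst.norm.rpow_const fun _ => Or.inr hβ0.le).add continuous_snd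
  · refine fun x₀ t₀ hz => ⟨fun φ hφ hmax hgrad => ?_, fun δ hδ φ _ _ hle hconst => ?_⟩
    · have hmin : IsLocalMinOn (fun z => φ z - u z) (Qcyl n 1) (x₀, t₀) := by
        simpa only [neg_sub] using hmax.neg
      have hspace : IsLocalMin (fun x => φ (x, t₀) - ‖x‖ ^ β) x₀ := by
        filter_upwards [hmin.space_slice hz] with x hx
        simp only [u] at hx
        linarith
      have hφd : ContDiffAt ℝ 2 (fun x => φ (x, t₀)) x₀ := (hφ.1 t₀).contDiffAt
      have hx₀ : x₀ ≠ 0 := by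
        rintro rfl
        refine hgrad ?_
        rw [gradient_eq_of_isLocalMin_sub hspace (hφd.differentiableAt (by simp)) (hwd 0), hw0]
      have hG := Gpq_one_le_of_isLocalMin_sub (pp := pp) (qq := qq) (t := t₀) hp.le hspace hφd
        (contDiffAt_norm_rpow hx₀)
      have hφt : HasDerivAt (fun s => φ (x₀, s)) (deriv (fun s => φ (x₀, s)) t₀) t₀ :=
        ((hφ.2 x₀).differentiable (by simp) t₀).hasDerivAt
      have ht := deriv_nonpos_of_isLocalMinOn_Iic (hmin.time_slice hz)
        (hφt.sub ((hasDerivAt_id t₀).const_add (‖x₀‖ ^ β)))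
      rw [hfG hx₀]
      linarith
    · simp only [u, add_sub_assoc] at hconst
      refine absurd hconst (not_sSup_norm_rpow_add_locally_const hn hβ0 x₀ (hIoo hδ) ⟨t₀, ?_⟩)
      rintro _ ⟨t, ht, rfl⟩
      have := hle t ht
      simp only [u] at this
      linarith
  · refine fun x₀ t₀ hz => ⟨fun φ hφ hmin hgrad => ?_, fun δ hδ φ _ _ hle hconst => ?_⟩
    · have hspace : IsLocalMin (fun x => ‖x‖ ^ β - φ (x, t₀)) x₀ := by
        filter_upwards [hmin.space_slice hz] with x hx
        simp only [u] at hx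
        linarith
      have hφd : ContDiffAt ℝ 2 (fun x => φ (x, t₀)) x₀ := (hφ.1 t₀).contDiffAt
      have hx₀ : x₀ ≠ 0 := by
        rintro rfl
        refine hgrad ?_
        rw [← gradient_eq_of_isLocalMin_sub hspace (hwd 0) (hφd.differentiableAt (by simp)), hw0]
      have hG := Gpq_one_le_of_isLocalMin_sub (pp := pp) (qq := qq) (t := t₀) hp.le hspace
        (contDiffAt_norm_rpow hx₀) hφd
      have hφt : HasDerivAt (fun s => φ (x₀, s)) (deriv (fun s => φ (x₀, s)) t₀) t₀ :=
        ((hφ.2 x₀).differentiable (by simp) t₀).hasDerivAt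
      have ht := deriv_nonpos_of_isLocalMinOn_Iic (hmin.time_slice hz)
        (((hasDerivAt_id t₀).const_add (‖x₀‖ ^ β)).sub hφt)
      rw [hfG hx₀]
      linarith
    · simp only [u, add_sub_assoc] at hconst
      refine absurd hconst (not_sInf_norm_rpow_add_locally_const hn hβ0 x₀ (hIoo hδ) ⟨t₀, ?_⟩)
      rintro _ ⟨t, ht, rfl⟩
      have := hle t ht
      simp only [u] at this
      linarith
  · refine Continuous.continuousOn ?_
    rw [funext hf]
    have : Continuous fun z : Euc n × ℝ => ‖z.1‖ ^ ((qq - pp) / (p - 1)) :=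
      continuous_fst.norm.rpow_const fun _ => Or.inr hexp
    fun_prop
  · refine ⟨1 + n * (β ^ (p - 1) + β ^ (1 + qq)), fun z hz => ?_⟩
    have hz1 : ‖z.1‖ ^ ((qq - pp) / (p - 1)) ≤ 1 :=
      Real.rpow_le_one (norm_nonneg _) hz.1.le hexp
    have hz0 : 0 ≤ ‖z.1‖ ^ ((qq - pp) / (p - 1)) := by positivity
    have h₁ : 0 ≤ β ^ (p - 1) := by positivity
    have h₂ : 0 ≤ β ^ (1 + qq) := by positivity
    have h₃ : (n : ℝ) * (β ^ (p - 1) + ‖z.1‖ ^ ((qq - pp) / (p - 1)) * β ^ (1 + qq)) ≤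
        n * (β ^ (p - 1) + β ^ (1 + qq)) := by
      gcongr
      exact mul_le_of_le_one_left h₂ hz1
    have h₄ : 0 ≤ (n : ℝ) *
        (β ^ (p - 1) + ‖z.1‖ ^ ((qq - pp) / (p - 1)) * β ^ (1 + qq)) := by positivity
    rw [hf, abs_le]
    constructor <;> linarith
  · simp [u, Real.zero_rpow hβ0.ne']
  · simpa [sgrad, u] using hw0
  · rintro r ⟨hr, -⟩ z ⟨hx, ht, ht0⟩
    rw [sub_zero] at hx
    have hθβ : θ = β := hθ
    rw [hθβ] at ht
    have h₁ : ‖z.1‖ ^ β ≤ r ^ β := Real.rpow_le_rpow (norm_nonneg _) hx.le hβ0.le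
    have h₂ : 0 ≤ ‖z.1‖ ^ β := by positivity
    simp only [u]
    rw [abs_le]
    constructor <;> linarith

end
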